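/- The map w ↦ v(w), restricted to normalized finite words over {0,1,2,3}, is injective: if w and w' are normalized words with v(w) = v(w'), then w = w'. -/

import Mathlib

noncomputable section
open Matrix

noncomputable def φ : ℝ := (1 + Real.sqrt 5) / 2

noncomputable def σ : Fin 4 → Matrix (Fin 2) (Fin 2) ℝ
  | 0 => !![1, φ; 0, 1]
  | 1 => !![φ, φ; 1, φ]
  | 2 => !![φ, 1; φ, φ]
  | 3 => !![1, 0; φ, 1]

abbrev Word := List (Fin 4)

/-- v(w) = σ_{k₀} σ_{k₁} ⋯ σ_{kₙ} (1,0)ᵀ. -/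
noncomputable def vword (w : Word) : Fin 2 → ℝ := ((w.map σ).prod).mulVec ![1, 0]

/-- A word is normalized if it is empty or its last letter is nonzero. -/
def Normalized (w : Word) : Prop := ∀ h : w ≠ [], w.getLast h ≠ 0

theorem phi_sq : φ * φ = φ + 1 := by
  unfold φ
  have := Real.mul_self_sqrt (show (0:ℝ) ≤ 5 by norm_num)
  nlinarith

theorem phi_gt : 1 < φ := by
  unfold φ
  have : (1:ℝ) < Real.sqrt 5 := by
    rw [Real.lt_sqrt] <;> norm_num
  linarith

theorem vword_nil : vword [] = ![1, 0] := by simp [vword]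

theorem vword_cons (k : Fin 4) (w : Word) : vword (k :: w) = (σ k).mulVec (vword w) := by
  rw [vword, vword, Matrix.mulVec_mulVec, List.map_cons, List.prod_cons]

theorem norm_tail {k : Fin 4} {w : Word} (h : Normalized (k :: w)) : Normalized w := by
  intro hne
  have := h (by simp)
  rwa [List.getLast_cons hne] at this

theorem s0 (v : Fin 2 → ℝ) : (σ 0).mulVec v = ![v 0 + φ * v 1, v 1] := by
  ext i; fin_cases i <;> simp [σ, Matrix.mulVec, dotProduct, Fin.sum_univ_two]
theorem s1 (v : Fin 2 → ℝ) : (σ 1).mulVec v = ![φ * v 0 + φ * v 1, v 0 + φ * v 1] := by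
  ext i; fin_cases i <;> simp [σ, Matrix.mulVec, dotProduct, Fin.sum_univ_two]
theorem s2 (v : Fin 2 → ℝ) : (σ 2).mulVec v = ![φ * v 0 + v 1, φ * v 0 + φ * v 1] := by
  ext i; fin_cases i <;> simp [σ, Matrix.mulVec, dotProduct, Fin.sum_univ_two]
theorem s3 (v : Fin 2 → ℝ) : (σ 3).mulVec v = ![v 0, φ * v 0 + v 1] := by
  ext i; fin_cases i <;> simp [σ, Matrix.mulVec, dotProduct, Fin.sum_univ_two]

theorem vpos (w : Word) : 0 < vword w 0 ∧ 0 ≤ vword w 1 := by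
  have hp := phi_gt
  have hp0 : 0 < φ := by linarith
  induction w with
  | nil => simp [vword_nil]
  | cons k w ih =>
    obtain ⟨h0, h1⟩ := ih
    rw [vword_cons]
    fin_cases k <;> simp only [Fin.zero_eta, Fin.mk_one, Fin.reduceFinMk, s0, s1, s2, s3, Matrix.cons_val_zero, Matrix.cons_val_one] <;> constructor <;> positivity

theorem vpos1 (w : Word) (hw : Normalized w) (hne : w ≠ []) : 0 < vword w 1 := by
  have hp := phi_gt
  have hp0 : 0 < φ := by linarith
  induction w with
  | nil => exact absurd rfl hne
  | cons k w ih =>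
    obtain ⟨h0, h1⟩ := vpos w
    by_cases hk : k = 0
    · subst hk
      have hn : w ≠ [] := by
        rintro rfl
        exact hw (by simp) (by simp)
      rw [vword_cons, s0]
      simpa using ih (norm_tail hw) hn
    · rw [vword_cons]
      fin_cases k <;> first | exact absurd rfl hk | (simp only [Fin.zero_eta, Fin.mk_one, Fin.reduceFinMk, s0, s1, s2, s3, Matrix.cons_val_zero, Matrix.cons_val_one]; positivity)

theorem sigma_inj (k l : Fin 4) (u v : Fin 2 → ℝ) (hu : 0 < u 0 ∧ 0 ≤ u 1)
    (hv : 0 < v 0 ∧ 0 ≤ v 1) (h : (σ k).mulVec u = (σ l).mulVec v) : k = l ∧ u = v := by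
  have hp := phi_gt
  have hp0 : 0 < φ := by linarith
  have hq := phi_sq
  obtain ⟨a, b⟩ := hu
  obtain ⟨c, d⟩ := hv
  have e0 := congrFun h 0
  have e1 := congrFun h 1
  -- separating functionals
  have key : k = l := by
    have A := mul_pos (by linarith : 0 < φ) a
    have B := mul_nonneg (by linarith : 0 ≤ φ) b
    have C := mul_pos (by linarith : 0 < φ) c
    have D := mul_nonneg (by linarith : 0 ≤ φ) d
    have A' := mul_pos (by linarith : 0 < φ - 1) a
    have B' := mul_nonneg (by linarith : 0 ≤ φ - 1) b
    have C' := mul_pos (by linarith : 0 < φ - 1) c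
    have D' := mul_nonneg (by linarith : 0 ≤ φ - 1) d
    have q (x : ℝ) : φ * (φ * x) = φ * x + x := by rw [← mul_assoc, hq]; ring
    have f0 := congrArg (φ * ·) e0
    have f1 := congrArg (φ * ·) e1
    fin_cases k <;> fin_cases l <;> first | rfl | (exfalso; simp only [Fin.zero_eta, Fin.mk_one, Fin.reduceFinMk, s0, s1, s2, s3, Matrix.cons_val_zero, Matrix.cons_val_one, mul_add, q] at e0 e1 f0 f1; linarith)
  refine ⟨key, ?_⟩
  subst key
  have hdet : IsUnit (σ k) := by
    rw [Matrix.isUnit_iff_isUnit_det]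
    fin_cases k <;> simp [σ, Matrix.det_fin_two, hq]
  exact Matrix.mulVec_injective_of_isUnit hdet h

theorem stmt2 (w w' : Word) (hw : Normalized w) (hw' : Normalized w')
    (h : vword w = vword w') : w = w' := by
  induction w generalizing w' with
  | nil =>
    by_contra hne
    have := vpos1 w' hw' (Ne.symm hne)
    rw [← h, vword_nil] at this
    simp at this
  | cons k w ih =>
    cases w' with
    | nil =>
      have := vpos1 _ hw (by simp)
      rw [h, vword_nil] at this
      simp at this
    | cons l w' =>
      rw [vword_cons, vword_cons] at h
      obtain ⟨rfl, h2⟩ := sigma_inj k l _ _ (vpos w) (vpos w') h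
      rw [ih w' (norm_tail hw) (norm_tail hw') h2]
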